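/- For every 0 < β, δ' ≤ 1 and every integer ℓ ≥ 3 there exist ε₀ > 0 and n₀ ∈ ℕ such that for all ε ∈ (0, ε₀) and n ≥ n₀ the following holds. Let G be a (p,λ)-bijumbled graph on n vertices with p ∈ (0,1] and λ ≤ ε p² n. Let U be a vertex subset with |U| ≥ β n and let (aᵢ, bᵢ)_{i ∈ [r]} be a system of pairs of vertices of G such that every vertex occurs at most twice in the combined list (a₁, …, a_r, b₁, …, b_r), U is disjoint from ⋃ᵢ {aᵢ, bᵢ}, r ≤ |U| / (8ℓ), and deg(aᵢ, U) ≥ δ' p |U| and deg(bᵢ, U) ≥ δ' p |U| for all i ∈ [r]. Then there exists a family Q = {Q₁, …, Q_r} where each Qᵢ is an aᵢ–bᵢ path of length ℓ in G whose inner vertices lie in U, and the inner-vertex sets of the paths Qᵢ are pairwise disjoint. (Pairs with aᵢ = bᵢ are allowed, in which case Qᵢ is a cycle of length ℓ through aᵢ with all other vertices in U.) -/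

import Mathlib

open Finset

/-- The number of pairs `(a,b) ∈ A × B` with `ab` an edge of `G`
(edges inside `A ∩ B` are counted twice). -/
def ePairs {V : Type} [DecidableEq V] (G : SimpleGraph V) [DecidableRel G.Adj]
    (A B : Finset V) : ℕ :=
  ((A ×ˢ B).filter fun ab => G.Adj ab.1 ab.2).card

/-- `G` is `(p,λ)`-bijumbled: `|e(A,B) − p|A||B|| < λ√(|A||B|)` for all (nonempty)
vertex subsets `A, B`. -/
def Bijumbled {V : Type} [Fintype V] [DecidableEq V] (G : SimpleGraph V)
    [DecidableRel G.Adj] (p lam : ℝ) : Prop :=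
  ∀ A B : Finset V, A.Nonempty → B.Nonempty →
    |(ePairs G A B : ℝ) - p * A.card * B.card| < lam * Real.sqrt (A.card * B.card)

/-- `degIn G v U` is the number of neighbours of `v` in `U`, i.e. `|N_G(v) ∩ U|`. -/
def degIn {V : Type} [DecidableEq V] (G : SimpleGraph V) [DecidableRel G.Adj]
    (v : V) (U : Finset V) : ℕ :=
  (U.filter fun u => G.Adj v u).card

/-- `t` chooses a vertex of each class `C k`, `k ∈ I`, and the chosen vertices are pairwise
nonadjacent. -/
def IsIndepTransversal {α ι : Type*} (G : SimpleGraph α) (C : ι → Set α) (I : Finset ι)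
    (t : ι → α) : Prop :=
  (∀ k ∈ I, t k ∈ C k) ∧ ∀ k ∈ I, ∀ l ∈ I, k ≠ l → ¬ G.Adj (t k) (t l)

/-- **Haxell's theorem**, in a form suited to induction: if the classes indexed by `I` have no
independent transversal, but those indexed by `I \ {i₀}` do, then some `S ⊆ I` containing `i₀`
has all its classes totally dominated by at most `2 (|S| - 1)` vertices. -/
theorem exists_dominating_of_not_indepTransversal {α ι : Type*} [Finite α] [DecidableEq ι]
    [DecidableEq α] (n : ℕ) :
    ∀ (G : SimpleGraph α) (C : ι → Set α) (I : Finset ι) (i₀ : ι), I.card = n → i₀ ∈ I →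
      (∀ k ∈ I, ∀ l ∈ I, k ≠ l → Disjoint (C k) (C l)) →
      (∃ t, IsIndepTransversal G C (I.erase i₀) t) →
      (¬ ∃ t, IsIndepTransversal G C I t) →
      ∃ (S : Finset ι) (D : Finset α), S ⊆ I ∧ i₀ ∈ S ∧ D.card + 2 ≤ 2 * S.card ∧
        (∀ d ∈ D, ∃ k ∈ I, d ∈ C k) ∧ ∀ k ∈ S, ∀ v ∈ C k, ∃ d ∈ D, G.Adj v d := by
  induction n with
  | zero =>
    intro G C I i₀ hn hi
    rw [Finset.card_eq_zero] at hn
    simp [hn] at hi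
  | succ n ih =>
    intro G C I i₀ hn hi hdisj ⟨M, hM⟩ hno
    obtain hempty | ⟨v, hv⟩ := (C i₀).eq_empty_or_nonempty
    · exact ⟨{i₀}, ∅, by simpa using hi, by simp, by simp, by simp, by simp [hempty]⟩
    obtain ⟨H, -, ⟨hHG, hHno⟩, hHmin⟩ := exists_minimal_le_of_wellFoundedLT
      (fun H : SimpleGraph α ↦ H ≤ G ∧ ¬ ∃ t, IsIndepTransversal H C I t) G ⟨le_rfl, hno⟩
    have hclass : ∀ z k l, k ∈ I → l ∈ I → z ∈ C k → z ∈ C l → k = l := by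
      intro z k l hk hl hzk hzl
      by_contra hne
      exact Set.disjoint_left.mp (hdisj k hk l hl hne) hzk hzl
    -- an edge of `H` between the class of `i₀` and another class
    obtain ⟨x, y, hxy, hx⟩ : ∃ x y, H.Adj x y ∧ x ∈ C i₀ := by
      by_contra! hcon
      refine hHno ⟨Function.update M i₀ v, ?_, ?_⟩
      · intro k hk
        by_cases hki : k = i₀
        · subst hki; simpa using hv
        · simpa [hki] using hM.1 k (by simp [hki, hk])
      · intro k hk l hl hkl
        by_cases hki : k = i₀
        · subst hki
          simpa using fun h ↦ hcon _ _ h hv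
        · by_cases hli : l = i₀
          · subst hli
            simpa using fun h : H.Adj _ _ ↦ hcon _ _ h.symm hv
          · simpa [hki, hli] using fun h ↦
              hM.2 k (by simp [hki, hk]) l (by simp [hli, hl]) hkl (hHG h)
    -- deleting it creates an independent transversal, which uses both its ends
    obtain ⟨T, hT⟩ : ∃ t, IsIndepTransversal (H.deleteEdges {s(x, y)}) C I t := by
      by_contra hcon
      have := hHmin ⟨(H.deleteEdges_le _).trans hHG, hcon⟩ (H.deleteEdges_le _) hxy
      simp at this
    obtain ⟨j, hj, hji, hTi, hTj⟩ : ∃ j ∈ I, j ≠ i₀ ∧ T i₀ = x ∧ T j = y := by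
      by_contra! hcon
      refine hHno ⟨T, hT.1, fun k hk l hl hkl hadj ↦ hT.2 k hk l hl hkl ?_⟩
      rw [SimpleGraph.deleteEdges_adj]
      refine ⟨hadj, fun hmem ↦ ?_⟩
      rw [Set.mem_singleton_iff, Sym2.eq_iff] at hmem
      obtain ⟨h1, h2⟩ | ⟨h1, h2⟩ := hmem
      · obtain rfl := hclass x k i₀ hk hi (h1 ▸ hT.1 k hk) hx
        exact hcon l hl hkl.symm h1 h2
      · obtain rfl := hclass x l i₀ hl hi (h2 ▸ hT.1 l hl) hx
        exact hcon k hk hkl h2 h1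
    have hy : y ∈ C j := hTj ▸ hT.1 j hj
    -- merge the classes of `i₀` and `j` and delete the neighbours of `x` and `y`
    let C' : ι → Set α := fun k ↦
      {z | (z ∈ C k ∨ k = i₀ ∧ z ∈ C j) ∧ ¬ H.Adj z x ∧ ¬ H.Adj z y}
    have hC' : ∀ k ∈ I.erase j, ∀ z ∈ C' k, ∃ l ∈ I, z ∈ C l ∧ (l = k ∨ k = i₀ ∧ l = j) := by
      rintro k hk z ⟨h | ⟨rfl, h⟩, -⟩
      · exact ⟨k, Finset.mem_of_mem_erase hk, h, .inl rfl⟩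
      · exact ⟨j, hj, h, .inr ⟨rfl, rfl⟩⟩
    have hi' : i₀ ∈ I.erase j := Finset.mem_erase.mpr ⟨hji.symm, hi⟩
    have hdisj' : ∀ k ∈ I.erase j, ∀ l ∈ I.erase j, k ≠ l → Disjoint (C' k) (C' l) := by
      intro k hk l hl hkl
      rw [Set.disjoint_left]
      intro z hzk hzl
      obtain ⟨k', hk', hzk', hkk'⟩ := hC' k hk z hzk
      obtain ⟨l', hl', hzl', hll'⟩ := hC' l hl z hzl
      have := hclass z k' l' hk' hl' hzk' hzl'
      simp only [Finset.mem_erase] at hk hl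
      grind
    have hT' : ∃ t, IsIndepTransversal H C' ((I.erase j).erase i₀) t := by
      have key : ∀ k ∈ (I.erase j).erase i₀, ∀ m ∈ I, m ≠ k → m = i₀ ∨ m = j →
          ¬ H.Adj (T k) (T m) := by
        intro k hk m hm hmk hmij hadj
        simp only [Finset.mem_erase] at hk
        refine hT.2 k hk.2.2 m hm hmk.symm ?_
        rw [SimpleGraph.deleteEdges_adj]
        refine ⟨hadj, fun hmem ↦ ?_⟩
        rw [Set.mem_singleton_iff, Sym2.eq_iff] at hmem
        have h1 := hclass x k i₀ hk.2.2 hi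
        have h2 := hclass y k j hk.2.2 hj
        have h3 := hT.1 k hk.2.2
        grind
      refine ⟨T, ?_, ?_⟩
      · intro k hk
        have hk' := hk
        simp only [Finset.mem_erase] at hk'
        refine ⟨.inl (hT.1 k hk'.2.2), ?_, ?_⟩
        · rw [← hTi]; exact key k hk i₀ hi (Ne.symm hk'.1) (.inl rfl)
        · rw [← hTj]; exact key k hk j hj (Ne.symm hk'.2.1) (.inr rfl)
      · intro k hk l hl hkl hadj
        simp only [Finset.mem_erase] at hk hl
        refine hT.2 k hk.2.2 l hl.2.2 hkl ?_
        rw [SimpleGraph.deleteEdges_adj]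
        refine ⟨hadj, fun hmem ↦ ?_⟩
        rw [Set.mem_singleton_iff, Sym2.eq_iff] at hmem
        have h1 := hclass x k i₀ hk.2.2 hi
        have h2 := hclass x l i₀ hl.2.2 hi
        have h3 := hT.1 k hk.2.2
        have h4 := hT.1 l hl.2.2
        grind
    have hno' : ¬ ∃ t, IsIndepTransversal H C' (I.erase j) t := by
      rintro ⟨t, ht⟩
      have hnb : ∀ k ∈ I, k ≠ j → ¬ H.Adj (t k) x ∧ ¬ H.Adj (t k) y := fun k hk hkj ↦
        (ht.1 k (Finset.mem_erase.mpr ⟨hkj, hk⟩)).2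
      have hmem : ∀ k ∈ I, k ≠ j → k ≠ i₀ → t k ∈ C k := fun k hk hkj hki ↦
        (ht.1 k (Finset.mem_erase.mpr ⟨hkj, hk⟩)).1.resolve_right fun h ↦ hki h.1
      have hind : ∀ k ∈ I, ∀ l ∈ I, k ≠ j → l ≠ j → k ≠ l → ¬ H.Adj (t k) (t l) :=
        fun k hk l hl hkj hlj ↦
          ht.2 k (Finset.mem_erase.mpr ⟨hkj, hk⟩) l (Finset.mem_erase.mpr ⟨hlj, hl⟩)
      obtain h | ⟨-, h⟩ := (ht.1 i₀ hi').1
      · refine hHno ⟨fun k ↦ if k = j then y else t k, fun k hk ↦ ?_, fun k hk l hl hkl hadj ↦ ?_⟩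
        · grind
        · have hs := hadj.symm
          grind
      · refine hHno ⟨fun k ↦ if k = j then t i₀ else if k = i₀ then x else t k,
          fun k hk ↦ ?_, fun k hk l hl hkl hadj ↦ ?_⟩
        · grind
        · have hs := hadj.symm
          have h1 := hind k hk i₀ hi
          have h2 := hind l hl i₀ hi
          grind
    obtain ⟨S, D, hSI, hiS, hcard, hDC, hdom⟩ := ih H C' (I.erase j) i₀
        (by rw [Finset.card_erase_of_mem hj, hn]; rfl) hi' hdisj' hT' hno'
    refine ⟨insert j S, insert x (insert y D), ?_, by simp [hiS], ?_, ?_, ?_⟩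
    · exact Finset.insert_subset hj (hSI.trans (Finset.erase_subset _ _))
    · have hjS : j ∉ S := fun h ↦ by simpa using hSI h
      rw [Finset.card_insert_of_notMem hjS]
      have h1 := Finset.card_insert_le x (insert y D)
      have h2 := Finset.card_insert_le y D
      omega
    · simp only [Finset.mem_insert]
      rintro d (rfl | rfl | hd)
      · exact ⟨i₀, hi, hx⟩
      · exact ⟨j, hj, hy⟩
      · obtain ⟨k, hk, hdk⟩ := hDC d hd
        obtain ⟨l, hl, h, -⟩ := hC' k hk d hdk
        exact ⟨l, hl, h⟩
    · intro k hk z hz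
      by_cases hzx : H.Adj z x
      · exact ⟨x, by simp, hHG hzx⟩
      by_cases hzy : H.Adj z y
      · exact ⟨y, by simp, hHG hzy⟩
      obtain ⟨d, hd, h⟩ : ∃ d ∈ D, H.Adj z d := by
        obtain rfl | hk := Finset.mem_insert.mp hk
        · exact hdom i₀ hiS z ⟨.inr ⟨rfl, hz⟩, hzx, hzy⟩
        · exact hdom k hk z ⟨.inl hz, hzx, hzy⟩
      exact ⟨d, by simp [hd], hHG h⟩

/-- A system of disjoint representatives for hypergraphs `H i` with edges of size at most `m`
exists unless some `H i`, `i ∈ S`, have a common cover of size at most `2 m (|S| - 1)`. -/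
theorem exists_disjoint_representatives {V ι : Type*} [Finite V] [DecidableEq V] [Fintype ι]
    [DecidableEq ι] (H : ι → Set (Finset V)) (m : ℕ) (hm : ∀ i, ∀ F ∈ H i, F.card ≤ m)
    (hcover : ∀ (S : Finset ι) (W : Finset V), S.Nonempty → W.card ≤ 2 * m * (S.card - 1) →
      ∃ i ∈ S, ∃ F ∈ H i, Disjoint F W) :
    ∃ F : ι → Finset V, (∀ i, F i ∈ H i) ∧ ∀ i j, i ≠ j → Disjoint (F i) (F j) := by
  let G : SimpleGraph (ι × Finset V) := SimpleGraph.fromRel fun e f ↦ ¬ Disjoint e.2 f.2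
  let C : ι → Set (ι × Finset V) := fun i ↦ {e | e.1 = i ∧ e.2 ∈ H i}
  have hT : ∃ t, IsIndepTransversal G C Finset.univ t := by
    by_contra hno
    obtain ⟨I, -, hI⟩ := exists_minimal_le_of_wellFoundedLT
      (fun I : Finset ι ↦ ¬ ∃ t, IsIndepTransversal G C I t) Finset.univ hno
    obtain rfl | ⟨i₀, hi₀⟩ := I.eq_empty_or_nonempty
    · exact hI.1 ⟨fun i ↦ (i, ∅), by simp [IsIndepTransversal]⟩
    have hdisj : ∀ k ∈ I, ∀ l ∈ I, k ≠ l → Disjoint (C k) (C l) := by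
      intro k _ l _ hkl
      rw [Set.disjoint_left]
      rintro z ⟨rfl, -⟩ ⟨h, -⟩
      exact hkl h
    have herase : ∃ t, IsIndepTransversal G C (I.erase i₀) t := by
      by_contra hcon
      exact Finset.notMem_erase i₀ I (hI.2 hcon (Finset.erase_subset _ _) hi₀)
    obtain ⟨S, D, -, hiS, hcard, hDC, hdom⟩ :=
      exists_dominating_of_not_indepTransversal _ G C I i₀ rfl hi₀ hdisj herase hI.1
    obtain ⟨i, hi, F, hF, hFW⟩ := hcover S (D.biUnion Prod.snd) ⟨i₀, hiS⟩ <| by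
      calc (D.biUnion Prod.snd).card ≤ D.card * m := by
            refine Finset.card_biUnion_le_card_mul _ _ _ fun d hd ↦ ?_
            obtain ⟨k, -, -, hk⟩ := hDC d hd
            exact hm k _ hk
        _ ≤ (2 * (S.card - 1)) * m := Nat.mul_le_mul_right _ (by omega)
        _ = 2 * m * (S.card - 1) := by ring
    obtain ⟨d, hd, hadj⟩ := hdom i hi (i, F) ⟨rfl, hF⟩
    have hdis : Disjoint F d.2 := hFW.mono_right (Finset.subset_biUnion_of_mem Prod.snd hd)
    rw [SimpleGraph.fromRel_adj] at hadj
    exact hadj.2.elim (· hdis) (· hdis.symm)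
  obtain ⟨t, ht, hind⟩ := hT
  refine ⟨fun i ↦ (t i).2, fun i ↦ (ht i (Finset.mem_univ i)).2, fun i j hij ↦ ?_⟩
  by_contra hdis
  refine hind i (Finset.mem_univ i) j (Finset.mem_univ j) hij ?_
  rw [SimpleGraph.fromRel_adj]
  refine ⟨fun h ↦ hij ?_, .inl hdis⟩
  rw [← (ht i (Finset.mem_univ i)).1, ← (ht j (Finset.mem_univ j)).1, h]

theorem exists_disjoint_subsets {V : Type*} [DecidableEq V] (c m : ℕ) (Y : ℕ → Finset V)
    (hY : ∀ j < m, c * m ≤ (Y j).card) :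
    ∃ X : ℕ → Finset V, (∀ j < m, X j ⊆ Y j ∧ (X j).card = c) ∧
      ∀ j < m, ∀ k < m, j ≠ k → Disjoint (X j) (X k) := by
  suffices h : ∀ t ≤ m, ∃ X : ℕ → Finset V, (∀ j < t, X j ⊆ Y j ∧ (X j).card = c) ∧
      ∀ j < t, ∀ k < t, j ≠ k → Disjoint (X j) (X k) from h m le_rfl
  intro t
  induction t with
  | zero => simp
  | succ t ih =>
    intro ht
    obtain ⟨X, hX, hdisj⟩ := ih (by omega)
    have hcard : ((Finset.range t).biUnion X).card ≤ t * c := by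
      simpa using Finset.card_biUnion_le_card_mul (Finset.range t) X c
        fun j hj ↦ (hX j (Finset.mem_range.mp hj)).2.le
    obtain ⟨Z, hZ, hZc⟩ : ∃ Z ⊆ Y t \ (Finset.range t).biUnion X, Z.card = c := by
      refine Finset.exists_subset_card_eq ?_
      have h1 := Finset.le_card_sdiff ((Finset.range t).biUnion X) (Y t)
      have h2 := hY t (by omega)
      have h3 : c * (t + 1) ≤ c * m := Nat.mul_le_mul_left _ ht
      have h4 : c * (t + 1) = t * c + c := by ring
      omega
    have hZX : ∀ j < t, Disjoint (X j) Z := fun j hj ↦ by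
      rw [Finset.disjoint_left]
      intro v hv hvZ
      exact (Finset.mem_sdiff.mp (hZ hvZ)).2
        (Finset.mem_biUnion.mpr ⟨j, Finset.mem_range.mpr hj, hv⟩)
    refine ⟨Function.update X t Z, fun j hj ↦ ?_, fun j hj k hk hjk ↦ ?_⟩
    · obtain rfl | hjt := eq_or_ne j t
      · simpa [hZc] using hZ.trans Finset.sdiff_subset
      · simpa [hjt] using hX j (by omega)
    · obtain rfl | hjt := eq_or_ne j t
      · simpa [hjk.symm] using (hZX k (by omega)).symm
      · obtain rfl | hkt := eq_or_ne k t
        · simpa [hjk] using hZX j (by omega)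
        · simpa [hjt, hkt] using hdisj j (by omega) k (by omega) hjk

section Linking

variable {V : Type} [DecidableEq V] (G : SimpleGraph V)

/-- Every two sets of at least `s` vertices span an edge between them. -/
def EdgeBetween (s : ℕ) : Prop :=
  ∀ A B : Finset V, s ≤ A.card → s ≤ B.card → ∃ x ∈ A, ∃ y ∈ B, G.Adj x y

variable {G}

theorem EdgeBetween.exists_transversal_walk {s : ℕ} (hs : EdgeBetween G s) (hs1 : 1 ≤ s)
    (X : ℕ → Finset V) (m : ℕ) (hX : ∀ j ≤ m, 2 * s ≤ (X j).card) :
    ∃ f : ℕ → V, (∀ k ≤ m, f k ∈ X k) ∧ ∀ k < m, G.Adj (f k) (f (k + 1)) := by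
  classical
  suffices h : ∀ j ≤ m, ∃ R ⊆ X j, s ≤ R.card ∧ ∀ v ∈ R, ∃ f : ℕ → V,
      (∀ k ≤ j, f k ∈ X k) ∧ (∀ k < j, G.Adj (f k) (f (k + 1))) ∧ f j = v by
    obtain ⟨R, -, hR, hf⟩ := h m le_rfl
    obtain ⟨v, hv⟩ := Finset.card_pos.mp (hs1.trans hR)
    obtain ⟨f, h1, h2, -⟩ := hf v hv
    exact ⟨f, h1, h2⟩
  intro j
  induction j with
  | zero =>
    intro hj
    refine ⟨X 0, subset_rfl, by have := hX 0 hj; omega, fun v hv ↦ ⟨fun _ ↦ v, ?_, ?_, rfl⟩⟩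
    · simpa using hv
    · simp
  | succ j ih =>
    intro hj
    obtain ⟨R, -, hR, hf⟩ := ih (by omega)
    let N := (X (j + 1)).filter fun v ↦ ∃ u ∈ R, G.Adj u v
    refine ⟨N, Finset.filter_subset _ _, ?_, fun v hv ↦ ?_⟩
    · by_contra! hN
      have h1 := Finset.le_card_sdiff N (X (j + 1))
      have h2 := hX (j + 1) hj
      obtain ⟨u, hu, v, hv, huv⟩ := hs R (X (j + 1) \ N) hR (by omega)
      rw [Finset.mem_sdiff] at hv
      exact hv.2 (Finset.mem_filter.mpr ⟨hv.1, u, hu, huv⟩)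
    · obtain ⟨hvX, u, hu, huv⟩ := Finset.mem_filter.mp hv
      obtain ⟨f, hfX, hfadj, rfl⟩ := hf u hu
      refine ⟨Function.update f (j + 1) v, fun k hk ↦ ?_, fun k hk ↦ ?_, by simp⟩
      · obtain rfl | hne := eq_or_ne k (j + 1)
        · simpa using hvX
        · simpa [hne] using hfX k (by omega)
      · have hne : k ≠ j + 1 := by omega
        obtain rfl | hkj := eq_or_ne k j
        · simpa using huv
        · simpa [hne, hkj] using hfadj k (by omega)

/-- `F` is the set of inner vertices of an `a`–`b` path (or cycle, if `a = b`) of length `ℓ`. -/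
def IsLink (G : SimpleGraph V) (a b : V) (ℓ : ℕ) (F : Finset V) : Prop :=
  ∃ f : ℕ → V, f 0 = a ∧ f ℓ = b ∧ (∀ k < ℓ, G.Adj (f k) (f (k + 1))) ∧
    Set.InjOn f (Finset.Ioo 0 ℓ) ∧ (Finset.Ioo 0 ℓ).image f = F

theorem IsLink.card_le {a b : V} {ℓ : ℕ} {F : Finset V} (h : IsLink G a b ℓ F) :
    F.card ≤ ℓ - 1 := by
  obtain ⟨f, -, -, -, -, rfl⟩ := h
  simpa using Finset.card_image_le (s := Finset.Ioo 0 ℓ) (f := f)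

theorem EdgeBetween.exists_isLink [DecidableRel G.Adj] {s : ℕ} (hs : EdgeBetween G s)
    (hs1 : 1 ≤ s) {a b : V} {ℓ : ℕ} (hℓ : 3 ≤ ℓ) {T : Finset V}
    (ha : 2 * s * (ℓ - 1) ≤ degIn G a T) (hb : 2 * s * (ℓ - 1) ≤ degIn G b T) :
    ∃ F ⊆ T, IsLink G a b ℓ F := by
  obtain ⟨m, rfl⟩ : ∃ m, ℓ = m + 2 := ⟨ℓ - 2, by omega⟩
  let Y : ℕ → Finset V := fun j ↦ T.filter fun u ↦ G.Adj (if j = m then b else a) u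
  obtain ⟨X, hX, hdisj⟩ := exists_disjoint_subsets (2 * s) (m + 1) Y <| by
    intro j _
    by_cases hj : j = m
    · simpa [Y, hj, degIn] using hb
    · simpa [Y, hj, degIn] using ha
  obtain ⟨f, hfX, hadj⟩ := hs.exists_transversal_walk hs1 X m
    fun j hj ↦ (hX j (by omega)).2.ge
  have hfY : ∀ k ≤ m, f k ∈ T ∧ G.Adj (if k = m then b else a) (f k) := fun k hk ↦
    Finset.mem_filter.mp ((hX k (by omega)).1 (hfX k hk))
  have hb' : G.Adj (f m) b := by simpa using (hfY m le_rfl).2.symm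
  have ha' : G.Adj a (f 0) := by
    simpa [show 0 ≠ m by omega] using (hfY 0 (by omega)).2
  refine ⟨(Finset.Ioo 0 (m + 2)).image fun k ↦ f (k - 1), ?_,
    fun k ↦ if k = 0 then a else if k = m + 2 then b else f (k - 1),
    by simp, by simp, fun k hk ↦ ?_, fun j hj k hk hjk ↦ ?_, ?_⟩
  · intro v hv
    obtain ⟨k, hk, rfl⟩ := Finset.mem_image.mp hv
    rw [Finset.mem_Ioo] at hk
    exact (hfY (k - 1) (by omega)).1
  · obtain rfl | hk0 := Nat.eq_zero_or_pos k
    · simpa using ha'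
    · obtain rfl | hkm := eq_or_ne k (m + 1)
      · simpa using hb'
      · have h := hadj (k - 1) (by omega)
        rw [show k - 1 + 1 = k by omega] at h
        dsimp only
        rw [if_neg (by omega), if_neg (by omega), if_neg (by omega), if_neg (by omega)]
        exact h
  · rw [Finset.mem_coe, Finset.mem_Ioo] at hj hk
    dsimp only at hjk
    rw [if_neg (by omega), if_neg (by omega), if_neg (by omega), if_neg (by omega)] at hjk
    by_contra hne
    refine Finset.disjoint_left.mp (hdisj (j - 1) (by omega) (k - 1) (by omega) (by omega))
      (hfX _ (by omega)) ?_
    rw [hjk]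
    exact hfX _ (by omega)
  · refine Finset.image_congr fun k hk ↦ ?_
    rw [Finset.mem_coe, Finset.mem_Ioo] at hk
    rw [if_neg (by omega), if_neg (by omega)]

theorem IsLink.exists_walk {a b : V} {ℓ : ℕ} (hℓ : 3 ≤ ℓ) {F : Finset V}
    (h : IsLink G a b ℓ F) (ha : a ∉ F) (hb : b ∉ F) :
    ∃ Q : G.Walk a b, Q.length = ℓ ∧ (a ≠ b → Q.IsPath) ∧
      (∀ h : a = b, (Q.copy rfl h.symm).IsCycle) ∧ ∀ v ∈ Q.support, v ≠ a → v ≠ b → v ∈ F := by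
  obtain ⟨f, rfl, rfl, hadj, hinj, rfl⟩ := h
  obtain ⟨m, rfl⟩ : ∃ m, ℓ = m + 1 := ⟨ℓ - 1, by omega⟩
  have hwalk : ∀ n ≤ m, ∃ w : G.Walk (f 1) (f (n + 1)),
      w.length = n ∧ w.support = (List.range (n + 1)).map fun k ↦ f (k + 1) := by
    intro n
    induction n with
    | zero => exact fun _ ↦ ⟨.nil, by simp⟩
    | succ n ih =>
      intro hn
      obtain ⟨w, hw, hsupp⟩ := ih (by omega)
      refine ⟨w.concat (hadj (n + 1) (by omega)), by simp [hw], ?_⟩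
      rw [SimpleGraph.Walk.support_concat, hsupp, List.range_succ (n := n + 1)]
      simp
  have hne : ∀ k, 0 < k → k < m + 1 → f k ≠ f 0 ∧ f k ≠ f (m + 1) := fun k h0 hk ↦
    ⟨fun h ↦ ha (h ▸ Finset.mem_image_of_mem f (by simp; omega)),
      fun h ↦ hb (h ▸ Finset.mem_image_of_mem f (by simp; omega))⟩
  obtain ⟨w, hw, hsupp⟩ := hwalk m le_rfl
  have hmem : ∀ v, v ∈ w.support ↔ ∃ k < m + 1, f (k + 1) = v := fun v ↦ by simp [hsupp]
  have hpath : w.IsPath := by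
    rw [SimpleGraph.Walk.isPath_def, hsupp]
    refine List.Nodup.map_on (fun j hj k hk hjk ↦ ?_) List.nodup_range
    rw [List.mem_range] at hj hk
    obtain rfl | hj' := eq_or_ne j m
    · by_contra hkm
      exact (hne (k + 1) (by omega) (by omega)).2 hjk.symm
    obtain rfl | hk' := eq_or_ne k m
    · exact absurd hjk (hne (j + 1) (by omega) (by omega)).2
    have := hinj (by simp; omega) (by simp; omega) hjk
    omega
  refine ⟨.cons (hadj 0 (by omega)) w, by simp [hw], fun hab ↦ ?_, fun hab ↦ ?_, ?_⟩
  · rw [SimpleGraph.Walk.cons_isPath_iff]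
    refine ⟨hpath, fun h0 ↦ ?_⟩
    obtain ⟨k, hk, hk0⟩ := (hmem _).mp h0
    obtain rfl | hkm := eq_or_ne k m
    · exact hab hk0.symm
    · exact (hne (k + 1) (by omega) (by omega)).1 hk0
  · rw [SimpleGraph.Walk.copy_cons, SimpleGraph.Walk.cons_isCycle_iff]
    have hp : (w.copy rfl hab.symm).IsPath := by simpa using hpath
    refine ⟨hp, fun h ↦ ?_⟩
    rw [Sym2.eq_swap] at h
    have := hp.length_eq_one_of_mem_edges h
    simp at this
    omega
  · intro v hv hva hvb
    rw [SimpleGraph.Walk.support_cons, List.mem_cons] at hv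
    obtain ⟨k, hk, rfl⟩ := (hmem v).mp (hv.resolve_left hva)
    obtain rfl | hkm := eq_or_ne k m
    · exact absurd rfl hvb
    · exact Finset.mem_image_of_mem f (by simp; omega)

end Linking

section Bijumbled

variable {V : Type} [DecidableEq V] {G : SimpleGraph V} [DecidableRel G.Adj]

theorem ePairs_eq_sum_degIn (A B : Finset V) : ePairs G A B = ∑ v ∈ A, degIn G v B := by
  simp only [ePairs, degIn, Finset.card_filter, Finset.sum_product]

theorem degIn_sdiff_add_degIn (v : V) {U W : Finset V} (hW : W ⊆ U) :
    degIn G v (U \ W) + degIn G v W = degIn G v U := by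
  unfold degIn
  rw [← Finset.card_union_of_disjoint
    (Finset.disjoint_filter_filter Finset.sdiff_disjoint), ← Finset.filter_union,
    Finset.sdiff_union_of_subset hW]

variable [Fintype V] {p lam : ℝ}

theorem Bijumbled.abs_ePairs_sub_le (h : Bijumbled G p lam) (A B : Finset V) :
    |(ePairs G A B : ℝ) - p * A.card * B.card| ≤ lam * Real.sqrt (A.card * B.card) := by
  obtain rfl | hA := A.eq_empty_or_nonempty
  · simp [ePairs]
  obtain rfl | hB := B.eq_empty_or_nonempty
  · simp [ePairs]
  exact (h A B hA hB).le

theorem Bijumbled.lt_lam (h : Bijumbled G p lam) (v : V) : p < lam := by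
  have h1 := h {v} {v} (Finset.singleton_nonempty v) (Finset.singleton_nonempty v)
  have h2 : ePairs G {v} {v} = 0 := by simp [ePairs, Finset.filter_singleton]
  rw [h2] at h1
  simp only [Finset.card_singleton, Nat.cast_zero, Nat.cast_one, mul_one, zero_sub, abs_neg,
    Real.sqrt_one] at h1
  exact (le_abs_self p).trans_lt h1

theorem Bijumbled.edgeBetween (h : Bijumbled G p lam) (hp : 0 < p) {s : ℕ} (hs1 : 1 ≤ s)
    (hs : lam ≤ p * s) : EdgeBetween G s := by
  intro A B hA hB
  by_contra! hcon
  have h1 := h A B (Finset.card_pos.mp (hs1.trans hA)) (Finset.card_pos.mp (hs1.trans hB))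
  have h2 : ePairs G A B = 0 := by
    rw [ePairs, Finset.card_eq_zero, Finset.filter_eq_empty_iff]
    rintro ⟨x, y⟩ hxy
    rw [Finset.mem_product] at hxy
    exact hcon x hxy.1 y hxy.2
  have hA' : (s : ℝ) ≤ A.card := by exact_mod_cast hA
  have hB' : (s : ℝ) ≤ B.card := by exact_mod_cast hB
  have hs0 : (1 : ℝ) ≤ s := by exact_mod_cast hs1
  set x : ℝ := Real.sqrt (A.card * B.card)
  have hxx : x * x = A.card * B.card := Real.mul_self_sqrt (by positivity)
  have hsx : (s : ℝ) ≤ x := Real.le_sqrt_of_sq_le (by nlinarith)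
  have hx0 : 0 < x := by linarith
  rw [h2, Nat.cast_zero, zero_sub, abs_neg, mul_assoc, ← hxx, abs_of_pos (by positivity),
    ← mul_assoc] at h1
  have h3 := lt_of_mul_lt_mul_right h1 hx0.le
  have h4 := mul_le_mul_of_nonneg_left hsx hp.le
  linarith

theorem card_bound_of_le {ε β p lam n a x : ℝ} (hε : 0 < ε) (hp : 0 < p) (hp1 : p ≤ 1)
    (hn : 0 < n) (ha : 0 < a) (hx : 0 < x) (hβx : 3 * (β * n) ≤ 4 * x)
    (hlam : lam ≤ ε * p ^ 2 * n) (h : p * (a * x) ≤ 2 * (lam * √(a * x))) :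
    3 * (a * β) ≤ 16 * ε ^ 2 * n := by
  have hy : 0 < √(a * x) := Real.sqrt_pos.mpr (by positivity)
  have hyy : √(a * x) * √(a * x) = a * x := Real.mul_self_sqrt (by positivity)
  generalize √(a * x) = y at *
  have h1 : p * y ≤ 2 * lam := by
    refine le_of_mul_le_mul_right ?_ hy
    rw [mul_assoc, hyy]
    linarith
  have h2 : y ≤ 2 * (ε * n) * p := by
    refine le_of_mul_le_mul_left ?_ hp
    linarith
  have h3 : y ≤ 2 * (ε * n) := h2.trans (mul_le_of_le_one_right (by positivity) hp1)
  have h4 := mul_self_le_mul_self hy.le h3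
  have h5 := mul_le_mul_of_nonneg_left hβx ha.le
  refine le_of_mul_le_mul_left ?_ hn
  linarith

/-- Only few vertices with large degree into `U` lose most of it when `W` is removed. -/
theorem Bijumbled.four_mul_card_lt (h : Bijumbled G p lam) {ε β δ ℓ : ℝ} (hε : 0 < ε)
    (hβ : 0 < β) (hβ1 : β ≤ 1) (hδ : 0 < δ) (hδ1 : δ ≤ 1) (hℓ : 1 ≤ ℓ)
    (hεlt : ε < δ * β ^ 2 / (100 * ℓ)) (hp : 0 < p) (hp1 : p ≤ 1)
    (hlam : lam ≤ ε * p ^ 2 * Fintype.card V) {U W A : Finset V} (hU : β * Fintype.card V ≤ U.card)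
    (hWU : W ⊆ U) (hW4 : 4 * (W.card : ℝ) ≤ U.card) (hA : A.Nonempty)
    (hdeg : ∀ v ∈ A, δ * p * U.card ≤ degIn G v U)
    (hlow : ∀ v ∈ A, (degIn G v (U \ W) : ℝ) ≤ 4 * ε * ℓ * p * Fintype.card V) :
    4 * ℓ * A.card < W.card := by
  by_contra! hWA
  obtain ⟨v, hv⟩ := hA
  have hlam0 : 0 < lam := hp.trans (h.lt_lam v)
  have hn : (0 : ℝ) < Fintype.card V := by exact_mod_cast Fintype.card_pos_iff.mpr ⟨v⟩
  have ha : (0 : ℝ) < A.card := by exact_mod_cast Finset.card_pos.mpr ⟨v, hv⟩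
  have hx : ((U \ W).card : ℝ) = U.card - W.card := by
    rw [Finset.card_sdiff_of_subset hWU, Nat.cast_sub (Finset.card_le_card hWU)]
  have e1 := abs_le.mp (h.abs_ePairs_sub_le A (U \ W))
  have e2 := abs_le.mp (h.abs_ePairs_sub_le A W)
  have e3 : (ePairs G A (U \ W) : ℝ) ≤ A.card * (4 * ε * ℓ * p * Fintype.card V) := by
    rw [ePairs_eq_sum_degIn, Nat.cast_sum, ← nsmul_eq_mul]
    exact Finset.sum_le_card_nsmul _ _ _ hlow
  have e4 : A.card * (δ * p * U.card) ≤ (ePairs G A (U \ W) : ℝ) + ePairs G A W := by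
    rw [ePairs_eq_sum_degIn, ePairs_eq_sum_degIn, ← Nat.cast_add, ← Finset.sum_add_distrib,
      Finset.sum_congr rfl fun v _ ↦ degIn_sdiff_add_degIn v hWU, Nat.cast_sum, ← nsmul_eq_mul]
    exact Finset.card_nsmul_le_sum _ _ _ hdeg
  have hw0 : (0 : ℝ) ≤ W.card := by positivity
  generalize (ePairs G A (U \ W) : ℝ) = E1 at *
  generalize (ePairs G A W : ℝ) = E2 at *
  generalize ((U \ W).card : ℝ) = x at *
  generalize (Fintype.card V : ℝ) = n at *
  generalize (A.card : ℝ) = a at *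
  generalize (W.card : ℝ) = w at *
  generalize (U.card : ℝ) = u at *
  have hx0 : 3 * (β * n) ≤ 4 * x := by linarith
  have hβn : 0 < β * n := by positivity
  have hxpos : 0 < x := by linarith
  have hε' : 100 * ℓ * ε < δ * β ^ 2 := by
    rw [lt_div_iff₀ (by positivity)] at hεlt
    linarith
  have hδβ : δ * β ^ 2 ≤ β := by nlinarith [mul_pos hδ hβ]
  have hβ2 : β ^ 2 ≤ 1 := by nlinarith
  have hε1 : ε ≤ 1 := by nlinarith
  -- few vertices have degree into `U \ W` well below the expected one
  have h1 : 2 * (4 * ε * ℓ * p * n) ≤ p * x := by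
    have h2 : 100 * (ℓ * ε * n) ≤ β * n := by
      have := mul_le_mul_of_nonneg_right (hε'.le.trans hδβ) hn.le
      linarith
    have h3 : 0 < ℓ * ε * n := by positivity
    have h4 : 8 * (ℓ * ε * n) ≤ x := by linarith
    have := mul_le_mul_of_nonneg_left h4 hp.le
    linarith
  have h2 : p * (a * x) ≤ 2 * (lam * √(a * x)) := by
    have := mul_le_mul_of_nonneg_left h1 ha.le
    linarith [e1.1]
  have h3 := card_bound_of_le hε hp hp1 hn ha hxpos hx0 hlam h2
  have h4 : √(a * w) ≤ 2 * ℓ * a := by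
    refine Real.sqrt_le_iff.mpr ⟨by positivity, ?_⟩
    have h5 := mul_le_mul_of_nonneg_left hWA ha.le
    have h6 := mul_le_mul_of_nonneg_left hℓ (by positivity : 0 ≤ 4 * ℓ * (a * a))
    linarith
  have h5 : δ * p * u ≤ 4 * ε * ℓ * p * n + 4 * ℓ * p * a + 2 * ℓ * lam := by
    refine le_of_mul_le_mul_left ?_ ha
    have h6 : lam * √(a * w) ≤ lam * (2 * ℓ * a) := mul_le_mul_of_nonneg_left h4 hlam0.le
    have h7 : p * a * w ≤ p * a * (4 * ℓ * a) := mul_le_mul_of_nonneg_left hWA (by positivity)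
    linarith [e2.2]
  have h6 : δ * u ≤ 6 * ε * ℓ * n + 4 * ℓ * a := by
    refine le_of_mul_le_mul_left ?_ hp
    have h7 : ℓ * lam ≤ ℓ * (ε * p ^ 2 * n) := mul_le_mul_of_nonneg_left hlam (by positivity)
    have h8 : p * (p * (ℓ * ε * n)) ≤ 1 * (p * (ℓ * ε * n)) :=
      mul_le_mul_of_nonneg_right hp1 (by positivity)
    linarith
  have h7 : 3 * β * (δ * (β * n)) ≤ 18 * (β * (ε * ℓ * n)) + 64 * (ε * (ε * ℓ * n)) := by
    have h8 := mul_le_mul_of_nonneg_left hU (by positivity : 0 ≤ 3 * β * δ)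
    have h9 := mul_le_mul_of_nonneg_left h6 (by positivity : 0 ≤ 3 * β)
    have h10 := mul_le_mul_of_nonneg_left h3 (by positivity : 0 ≤ 4 * ℓ)
    linarith
  have h8 : 0 < ε * ℓ * n := by positivity
  have h9 := mul_le_mul_of_nonneg_right hβ1 h8.le
  have h10 := mul_le_mul_of_nonneg_right hε1 h8.le
  have h11 := mul_lt_mul_of_pos_right hε' hn
  linarith

end Bijumbled


/-- multiple connection lemma: for `0 < β, δ' ≤ 1` and `ℓ ≥ 3` there are
`ε₀ > 0` and `n₀` such that for all `ε ∈ (0,ε₀)` and `n ≥ n₀` the following holds in any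
`(p,λ)`-bijumbled graph with `p ∈ (0,1]` and `λ ≤ ε p² n`. Given a set `U` with
`|U| ≥ β n` and pairs `(aᵢ,bᵢ)`, `i ∈ [r]`, with every vertex occurring at most twice in
the combined list, `U` disjoint from all `aᵢ, bᵢ`, `r ≤ |U|/(8ℓ)`, and
`deg(aᵢ,U), deg(bᵢ,U) ≥ δ' p |U|`, there are `aᵢ`–`bᵢ`-paths `Qᵢ` of length `ℓ` (cycles
through `aᵢ` if `aᵢ = bᵢ`) whose inner vertices lie in `U` and are pairwise disjoint. -/
theorem stmt14 (β δ' : ℝ) (hβ0 : 0 < β) (hβ1 : β ≤ 1) (hδ0 : 0 < δ') (hδ1 : δ' ≤ 1)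
    (ℓ : ℕ) (hℓ : 3 ≤ ℓ) :
    ∃ ε₀ : ℝ, 0 < ε₀ ∧ ∃ n₀ : ℕ, ∀ ε : ℝ, 0 < ε → ε < ε₀ →
    ∀ (V : Type) [Fintype V] [DecidableEq V] (G : SimpleGraph V) [DecidableRel G.Adj],
      n₀ ≤ Fintype.card V →
      ∀ p lam : ℝ, 0 < p → p ≤ 1 → lam ≤ ε * p ^ 2 * Fintype.card V →
      Bijumbled G p lam →
      ∀ (U : Finset V) (r : ℕ) (a b : Fin r → V),
      β * (Fintype.card V : ℝ) ≤ U.card →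
      (∀ v : V, (Finset.univ.filter fun i => a i = v).card
          + (Finset.univ.filter fun i => b i = v).card ≤ 2) →
      (∀ i, a i ∉ U ∧ b i ∉ U) →
      (r : ℝ) ≤ (U.card : ℝ) / (8 * ℓ) →
      (∀ i, δ' * p * U.card ≤ (degIn G (a i) U : ℝ)
          ∧ δ' * p * U.card ≤ (degIn G (b i) U : ℝ)) →
      ∃ Q : ∀ i, G.Walk (a i) (b i),
        (∀ i, (Q i).length = ℓ) ∧
        (∀ i, a i ≠ b i → (Q i).IsPath) ∧
        (∀ i, ∀ h : a i = b i, ((Q i).copy rfl h.symm).IsCycle) ∧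
        (∀ i, ∀ v ∈ (Q i).support, v ≠ a i → v ≠ b i → v ∈ U) ∧
        (∀ i j, i ≠ j →
          Disjoint ((Q i).support.toFinset \ {a i, b i})
            ((Q j).support.toFinset \ {a j, b j})) := by
  have hℓ3 : (3 : ℝ) ≤ ℓ := by exact_mod_cast hℓ
  refine ⟨δ' * β ^ 2 / (100 * ℓ), by positivity, 0, ?_⟩
  intro ε hε hεlt V _ _ G _ _ p lam hp hp1 hlam hG U r a b hU hmult hab hr hdeg
  suffices hsystem : ∃ F : Fin r → Finset V, (∀ i, IsLink G (a i) (b i) ℓ (F i) ∧ F i ⊆ U) ∧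
      ∀ i j, i ≠ j → Disjoint (F i) (F j) by
    obtain ⟨F, hF, hdisj⟩ := hsystem
    choose Q hlen hpath hcycle hinner using fun i ↦ (hF i).1.exists_walk hℓ
      (fun h ↦ (hab i).1 ((hF i).2 h)) (fun h ↦ (hab i).2 ((hF i).2 h))
    have hsub : ∀ i, (Q i).support.toFinset \ {a i, b i} ⊆ F i := fun i v hv ↦ by
      simp only [mem_sdiff, List.mem_toFinset, mem_insert, mem_singleton, not_or] at hv
      exact hinner i v hv.1 hv.2.1 hv.2.2
    exact ⟨Q, hlen, hpath, hcycle, fun i v hv hva hvb ↦ (hF i).2 (hinner i v hv hva hvb),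
      fun i j hij ↦ (hdisj i j hij).mono (hsub i) (hsub j)⟩
  refine exists_disjoint_representatives
    (fun i ↦ {F : Finset V | IsLink G (a i) (b i) ℓ F ∧ F ⊆ U}) (ℓ - 1)
    (fun i F hF ↦ hF.1.card_le) fun S W hS hW ↦ ?_
  by_contra! hcon
  obtain ⟨i₀, hi₀⟩ := hS
  have hn : (0 : ℝ) < Fintype.card V := by exact_mod_cast Fintype.card_pos_iff.mpr ⟨a i₀⟩
  have hεpn : 1 < ε * p * Fintype.card V := by
    refine lt_of_mul_lt_mul_left ?_ hp.le
    linarith [hG.lt_lam (a i₀)]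
  set D : ℝ := 4 * ε * ℓ * p * Fintype.card V
  have hlink : ∀ i ∈ S, (degIn G (a i) (U \ (U ∩ W)) : ℝ) ≤ D ∨
      (degIn G (b i) (U \ (U ∩ W)) : ℝ) ≤ D := by
    intro i hi
    by_contra! hlarge
    set s : ℕ := ⌈ε * p * Fintype.card V⌉₊
    have hs1 : 1 ≤ s := Nat.ceil_pos.mpr (by positivity)
    have hsle : (s : ℝ) ≤ 2 * (ε * p * Fintype.card V) := by
      linarith [Nat.ceil_lt_add_one (by positivity : 0 ≤ ε * p * Fintype.card V)]
    have hedge : EdgeBetween G s := hG.edgeBetween hp hs1 <| by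
      have := mul_le_mul_of_nonneg_left (Nat.le_ceil (ε * p * Fintype.card V)) hp.le
      linarith
    have hsD : ((2 * s * (ℓ - 1) : ℕ) : ℝ) ≤ D := by
      have h1 : ((2 * s * (ℓ - 1) : ℕ) : ℝ) ≤ ((2 * s * ℓ : ℕ) : ℝ) := by
        exact_mod_cast Nat.mul_le_mul_left _ (Nat.sub_le _ _)
      have h2 := mul_le_mul_of_nonneg_right hsle (by positivity : (0 : ℝ) ≤ ℓ)
      push_cast at h1 ⊢
      linarith
    obtain ⟨F, hFU, hF⟩ := hedge.exists_isLink hs1 hℓ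
      (by exact_mod_cast hsD.trans hlarge.1.le) (by exact_mod_cast hsD.trans hlarge.2.le)
    refine hcon i hi F ⟨hF, hFU.trans sdiff_subset⟩ ?_
    rw [disjoint_left]
    intro v hv hvW
    have := mem_sdiff.mp (hFU hv)
    exact this.2 (mem_inter.mpr ⟨this.1, hvW⟩)
  let c : Fin r → V := fun i ↦ if (degIn G (a i) (U \ (U ∩ W)) : ℝ) ≤ D then a i else b i
  have hc : ∀ i, c i = a i ∨ c i = b i := fun i ↦ by
    dsimp only [c]; split_ifs <;> simp
  have hcard : S.card ≤ 2 * (S.image c).card := by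
    refine card_le_mul_card_image S 2 fun v _ ↦ le_trans ?_ (hmult v)
    refine le_trans (card_le_card fun i hi ↦ ?_) (card_union_le _ _)
    obtain h | h := hc i <;> simp_all
  have hWcard : (U ∩ W).card ≤ 2 * (ℓ - 1) * (S.card - 1) :=
    (card_le_card inter_subset_right).trans hW
  have hWS : ((U ∩ W).card : ℝ) ≤ 2 * ℓ * S.card := by
    exact_mod_cast hWcard.trans
      (Nat.mul_le_mul (Nat.mul_le_mul_left _ (Nat.sub_le _ _)) (Nat.sub_le _ _))
  have hSr : (S.card : ℝ) ≤ r := by exact_mod_cast S.card_le_univ.trans_eq (Fintype.card_fin r)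
  have hW4 : 4 * ((U ∩ W).card : ℝ) ≤ U.card := by
    rw [le_div_iff₀ (by positivity)] at hr
    have h1 := mul_le_mul_of_nonneg_left hSr (by positivity : (0 : ℝ) ≤ 8 * ℓ)
    linarith
  have hdegc : ∀ v ∈ S.image c, δ' * p * U.card ≤ degIn G v U := by
    intro v hv
    obtain ⟨i, -, rfl⟩ := mem_image.mp hv
    obtain h | h := hc i
    · rw [h]; exact (hdeg i).1
    · rw [h]; exact (hdeg i).2
  have hlow : ∀ v ∈ S.image c, (degIn G v (U \ (U ∩ W)) : ℝ) ≤ D := by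
    intro v hv
    obtain ⟨i, hi, rfl⟩ := mem_image.mp hv
    dsimp only [c]
    split_ifs with h
    · exact h
    · exact (hlink i hi).resolve_left h
  have hfew := hG.four_mul_card_lt hε hβ0 hβ1 hδ0 hδ1 (by linarith : (1 : ℝ) ≤ ℓ) hεlt hp hp1
    hlam hU inter_subset_left hW4 ⟨c i₀, mem_image_of_mem c hi₀⟩ hdegc hlow
  have h1 : (S.card : ℝ) ≤ 2 * (S.image c).card := by exact_mod_cast hcard
  have h2 := mul_le_mul_of_nonneg_left h1 (by positivity : (0 : ℝ) ≤ 2 * ℓ)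
  linarith
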